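/- (Core of Theorem 3.4.) Let x_* ∈ ℝⁿ, r > 0, and let f : ℝⁿ → ℝ be Lipschitz continuous with constant L_* on the open ball of radius r centered at x_*. Let (x_k) be a sequence with x_k → x_*, let (α_k) be positive reals with α_k → 0, and let (d_k) be unit vectors with d_k → d̄ for some unit vector d̄. Let ρ : ℝ → ℝ satisfy ρ(α) ≥ 0 for α > 0 and ρ(α)/α → 0 as α → 0⁺. Assume that for every k, f(x_k + α_k d_k) > f(x_k) − ρ(α_k). Then liminf_{k → ∞} ( f(x_k + α_k d̄) − f(x_k) ) / α_k ≥ 0. -/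

import Mathlib

open Filter Topology

/-- **core of Theorem 3.4.** If `f` is Lipschitz on a ball
around `x_*`, `x_k → x_*`, `α_k ↓ 0`, `d_k → d̄` are unit directions, `ρ ≥ 0`
with `ρ(α)/α → 0` as `α → 0⁺`, and every poll step is unsuccessful
(`f(x_k + α_k d_k) > f(x_k) − ρ(α_k)`), then
`liminf_k (f(x_k + α_k d̄) − f(x_k))/α_k ≥ 0`. -/
theorem liminf_diff_quotient_nonneg_of_unsuccessful_polls {n : ℕ}
    (xstar : EuclideanSpace ℝ (Fin n)) (r : ℝ) (hr : 0 < r)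
    (f : EuclideanSpace ℝ (Fin n) → ℝ) (Lstar : ℝ)
    (hlip : ∀ y ∈ Metric.ball xstar r, ∀ z ∈ Metric.ball xstar r,
      |f y - f z| ≤ Lstar * ‖y - z‖)
    (x : ℕ → EuclideanSpace ℝ (Fin n)) (hx : Tendsto x atTop (𝓝 xstar))
    (α : ℕ → ℝ) (hαpos : ∀ k, 0 < α k) (hα : Tendsto α atTop (𝓝 0))
    (d : ℕ → EuclideanSpace ℝ (Fin n)) (dbar : EuclideanSpace ℝ (Fin n))
    (hdunit : ∀ k, ‖d k‖ = 1) (hdbar : ‖dbar‖ = 1)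
    (hd : Tendsto d atTop (𝓝 dbar))
    (ρ : ℝ → ℝ) (hρnonneg : ∀ a : ℝ, 0 < a → 0 ≤ ρ a)
    (hρ : Tendsto (fun a => ρ a / a) (𝓝[>] (0 : ℝ)) (𝓝 0))
    (hpoll : ∀ k, f (x k + α k • d k) > f (x k) - ρ (α k)) :
    0 ≤ atTop.liminf (fun k => (f (x k + α k • dbar) - f (x k)) / α k) := by
  have hα' : Tendsto α atTop (𝓝[>] (0 : ℝ)) :=
    tendsto_nhdsWithin_iff.2 ⟨hα, Eventually.of_forall hαpos⟩
  have hg : Tendsto (fun k => -(ρ (α k) / α k) - Lstar * ‖dbar - d k‖) atTop (𝓝 0) := by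
    have h1 : Tendsto (fun k => ρ (α k) / α k) atTop (𝓝 0) := hρ.comp hα'
    have h2 : Tendsto (fun k => ‖dbar - d k‖) atTop (𝓝 0) := by
      simpa using (hd.const_sub dbar).norm
    simpa using h1.neg.sub (h2.const_mul Lstar)
  have m0 : ∀ᶠ k in atTop, x k ∈ Metric.ball xstar r := hx (Metric.ball_mem_nhds _ hr)
  have m1 : ∀ᶠ k in atTop, x k + α k • d k ∈ Metric.ball xstar r := by
    have h : Tendsto (fun k => x k + α k • d k) atTop (𝓝 xstar) := by
      simpa using hx.add (hα.smul hd)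
    exact h (Metric.ball_mem_nhds _ hr)
  have m2 : ∀ᶠ k in atTop, x k + α k • dbar ∈ Metric.ball xstar r := by
    have h : Tendsto (fun k => x k + α k • dbar) atTop (𝓝 xstar) := by
      simpa using hx.add (hα.smul_const dbar)
    exact h (Metric.ball_mem_nhds _ hr)
  have hlow : ∀ᶠ k in atTop, -(ρ (α k) / α k) - Lstar * ‖dbar - d k‖ ≤
      (f (x k + α k • dbar) - f (x k)) / α k := by
    filter_upwards [m1, m2] with k h1 h2
    have hp := hαpos k
    have h := (abs_le.1 (hlip _ h2 _ h1)).1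
    have e : ‖x k + α k • dbar - (x k + α k • d k)‖ = α k * ‖dbar - d k‖ := by
      rw [add_sub_add_left_eq_sub, ← smul_sub, norm_smul, Real.norm_of_nonneg hp.le]
    rw [e] at h
    have h3 := hpoll k
    rw [le_div_iff₀ hp, sub_mul, neg_mul, div_mul_cancel₀ _ hp.ne']
    linarith
  have hup : ∀ᶠ k in atTop, (f (x k + α k • dbar) - f (x k)) / α k ≤ Lstar := by
    filter_upwards [m0, m2] with k h0 h2
    have hp := hαpos k
    have h := (abs_le.1 (hlip _ h2 _ h0)).2
    rw [add_sub_cancel_left, norm_smul, hdbar, Real.norm_of_nonneg hp.le, mul_one] at h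
    rwa [div_le_iff₀ hp]
  have hb : IsBoundedUnder (· ≤ ·) atTop
      (fun k => (f (x k + α k • dbar) - f (x k)) / α k) := ⟨Lstar, hup⟩
  calc (0 : ℝ) = atTop.liminf (fun k => -(ρ (α k) / α k) - Lstar * ‖dbar - d k‖) :=
        hg.liminf_eq.symm
    _ ≤ _ := liminf_le_liminf hlow hg.isBoundedUnder_ge hb.isCoboundedUnder_ge
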